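/- arXiv:1803.10762 — 2 statements merged into one kernel-verified Lean document; each statement's English description precedes it below -/
import Mathlib

section
/- Let ϱ : ℝ² → ℝ be Lipschitz on bounded sets. Let f₁, f₂ : ℝ → ℝ be twice continuously differentiable on [0,∞) with f₁(0) = f₂(0) = 0 and N := (‖f₁‖²_{H²(ℝ₊)} + ‖f₂‖²_{H²(ℝ₊)})^{1/2} < ∞, and let L be a Lipschitz constant of ϱ on the closed Euclidean ball in ℝ² of radius 2N. Then for every n ∈ ℕ, n ≥ 1, |ϱ(2n²·∫_0^{1/n} f₁(y) dy, 2n²·∫_0^{1/n} f₂(y) dy) − ϱ(f₁'(0), f₂'(0))| ≤ n^{−1/2} · L · N. -/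
open MeasureTheory

/-- The Cauchy-Schwarz inequality against the constant function on an interval. -/
theorem sq_intervalIntegral_le {g : ℝ → ℝ} {a b : ℝ} (hab : a ≤ b)
    (hg : ContinuousOn g (Set.Icc a b)) :
    (∫ y in a..b, g y) ^ 2 ≤ (b - a) * ∫ y in a..b, g y ^ 2 := by
  rcases hab.eq_or_lt with rfl | hlt
  · simp
  have hba : 0 < b - a := sub_pos.2 hlt
  have hg1 : IntervalIntegrable g volume a b := hg.intervalIntegrable_of_Icc hab
  have hg2 : IntervalIntegrable (fun y => g y ^ 2) volume a b :=
    (hg.pow 2).intervalIntegrable_of_Icc hab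
  set I := ∫ y in a..b, g y with hI
  have key : 0 ≤ ∫ y in a..b, ((b - a) * g y - I) ^ 2 :=
    intervalIntegral.integral_nonneg hab fun y _ => sq_nonneg _
  have hexp : ∫ y in a..b, ((b - a) * g y - I) ^ 2 =
      (b - a) ^ 2 * (∫ y in a..b, g y ^ 2) - 2 * (b - a) * I * I + (b - a) * I ^ 2 := by
    have h : ∀ y, ((b - a) * g y - I) ^ 2 =
        (b - a) ^ 2 * g y ^ 2 - 2 * (b - a) * I * g y + I ^ 2 := fun y => by ring
    simp_rw [h]
    rw [intervalIntegral.integral_add ((hg2.const_mul _).sub (hg1.const_mul _))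
        intervalIntegrable_const,
      intervalIntegral.integral_sub (hg2.const_mul _) (hg1.const_mul _),
      intervalIntegral.integral_const_mul, intervalIntegral.integral_const_mul,
      intervalIntegral.integral_const, smul_eq_mul, ← hI]
  rw [hexp] at key
  have : 0 ≤ (b - a) * ((b - a) * (∫ y in a..b, g y ^ 2) - I ^ 2) := by linarith
  linarith [nonneg_of_mul_nonneg_right this hba]

section HalfLine

variable {f f' f'' : ℝ → ℝ}

theorem integrableOn_sq_of_integrableOn_sum_sq {g : ℝ → ℝ}
    (hg : ContinuousOn g (Set.Ici (0 : ℝ)))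
    (hInt : IntegrableOn (fun y => f y ^ 2 + f' y ^ 2 + f'' y ^ 2) (Set.Ioi (0 : ℝ)))
    (hle : ∀ y, g y ^ 2 ≤ f y ^ 2 + f' y ^ 2 + f'' y ^ 2) :
    IntegrableOn (fun y => g y ^ 2) (Set.Ioi (0 : ℝ)) := by
  refine Integrable.mono' hInt
    (((hg.mono Set.Ioi_subset_Ici_self).pow 2).aestronglyMeasurable measurableSet_Ioi)
    (ae_of_all _ fun y => ?_)
  rw [Real.norm_of_nonneg (sq_nonneg _)]
  exact hle y

/-- The trace inequality at the boundary of the half-line. -/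
theorem sq_deriv_zero_le_integral
    (hf'' : ∀ x ∈ Set.Ici (0 : ℝ), HasDerivWithinAt f' (f'' x) (Set.Ici 0) x)
    (hcont : ContinuousOn f'' (Set.Ici (0 : ℝ)))
    (hInt : IntegrableOn (fun y => f y ^ 2 + f' y ^ 2 + f'' y ^ 2) (Set.Ioi (0 : ℝ))) :
    f' 0 ^ 2 ≤ ∫ y in Set.Ioi (0 : ℝ), (f y ^ 2 + f' y ^ 2 + f'' y ^ 2) := by
  have hc' : ContinuousOn f' (Set.Ici (0 : ℝ)) := fun x hx => (hf'' x hx).continuousWithinAt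
  have hsq' : IntegrableOn (fun y => f' y ^ 2) (Set.Ioi (0 : ℝ)) :=
    integrableOn_sq_of_integrableOn_sum_sq hc' hInt fun y => by nlinarith
  have hmul : IntegrableOn (fun y => 2 * f' y * f'' y) (Set.Ioi (0 : ℝ)) := by
    refine Integrable.mono' hInt
      ((((continuousOn_const.mul hc').mul hcont).mono
        Set.Ioi_subset_Ici_self).aestronglyMeasurable measurableSet_Ioi)
      (ae_of_all _ fun y => ?_)
    rw [Real.norm_eq_abs, abs_le]
    constructor <;> nlinarith [sq_nonneg (f y), sq_nonneg (f' y + f'' y), sq_nonneg (f' y - f'' y)]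
  have hderiv : ∀ x ∈ Set.Ioi (0 : ℝ),
      HasDerivAt (fun y => f' y ^ 2) (2 * f' x * f'' x) x := fun x hx => by
    simpa using ((hf'' x (Set.mem_Ici_of_Ioi hx)).hasDerivAt (Ici_mem_nhds hx)).fun_pow 2
  have hlim := tendsto_zero_of_hasDerivAt_of_integrableOn_Ioi hderiv hmul hsq'
  have hFTC := integral_Ioi_of_hasDerivAt_of_tendsto
    ((hc' 0 Set.self_mem_Ici).pow 2) hderiv hmul hlim
  have hmono : ∫ y in Set.Ioi (0 : ℝ), -(2 * f' y * f'' y) ≤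
      ∫ y in Set.Ioi (0 : ℝ), (f y ^ 2 + f' y ^ 2 + f'' y ^ 2) :=
    integral_mono hmul.neg hInt fun y => by
      dsimp only
      nlinarith [sq_nonneg (f y), sq_nonneg (f' y + f'' y)]
  rw [integral_neg, hFTC] at hmono
  simpa using hmono

theorem sq_deriv_sub_deriv_zero_le
    (hf'' : ∀ x ∈ Set.Ici (0 : ℝ), HasDerivWithinAt f' (f'' x) (Set.Ici 0) x)
    (hcont : ContinuousOn f'' (Set.Ici (0 : ℝ)))
    (hInt : IntegrableOn (fun y => f y ^ 2 + f' y ^ 2 + f'' y ^ 2) (Set.Ioi (0 : ℝ)))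
    {z : ℝ} (hz : 0 ≤ z) :
    (f' z - f' 0) ^ 2 ≤ z * ∫ y in Set.Ioi (0 : ℝ), (f y ^ 2 + f' y ^ 2 + f'' y ^ 2) := by
  have hc : ContinuousOn f'' (Set.Icc 0 z) := hcont.mono Set.Icc_subset_Ici_self
  have hsq : IntegrableOn (fun y => f'' y ^ 2) (Set.Ioi (0 : ℝ)) :=
    integrableOn_sq_of_integrableOn_sum_sq hcont hInt fun y => by nlinarith
  have hFTC : ∫ y in (0 : ℝ)..z, f'' y = f' z - f' 0 :=
    intervalIntegral.integral_eq_sub_of_hasDerivAt_of_le hz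
      (fun x hx => (hf'' x hx.1).continuousWithinAt.mono Set.Icc_subset_Ici_self)
      (fun x hx => (hf'' x hx.1.le).hasDerivAt (Ici_mem_nhds hx.1))
      (hc.intervalIntegrable_of_Icc hz)
  have hCS := sq_intervalIntegral_le hz hc
  rw [hFTC, sub_zero] at hCS
  refine hCS.trans (mul_le_mul_of_nonneg_left ?_ hz)
  rw [intervalIntegral.integral_of_le hz]
  calc ∫ y in Set.Ioc 0 z, f'' y ^ 2 ≤ ∫ y in Set.Ioi (0 : ℝ), f'' y ^ 2 :=
        setIntegral_mono_set hsq (ae_of_all _ fun y => sq_nonneg _)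
          (Filter.Eventually.of_forall Set.Ioc_subset_Ioi_self)
    _ ≤ _ := integral_mono hsq hInt fun y => by dsimp only; nlinarith

/-- The normalised first moment of `f` near the boundary approximates `f' 0`. -/
theorem sq_average_sub_deriv_zero_le
    (hf' : ∀ x ∈ Set.Ici (0 : ℝ), HasDerivWithinAt f (f' x) (Set.Ici 0) x)
    (hf'' : ∀ x ∈ Set.Ici (0 : ℝ), HasDerivWithinAt f' (f'' x) (Set.Ici 0) x)
    (hcont : ContinuousOn f'' (Set.Ici (0 : ℝ))) (hf0 : f 0 = 0)
    (hInt : IntegrableOn (fun y => f y ^ 2 + f' y ^ 2 + f'' y ^ 2) (Set.Ioi (0 : ℝ)))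
    {h : ℝ} (hh : 0 < h) :
    (2 / h ^ 2 * (∫ y in (0 : ℝ)..h, f y) - f' 0) ^ 2 ≤
      h * ∫ y in Set.Ioi (0 : ℝ), (f y ^ 2 + f' y ^ 2 + f'' y ^ 2) := by
  set A := ∫ y in Set.Ioi (0 : ℝ), (f y ^ 2 + f' y ^ 2 + f'' y ^ 2)
  have hA : 0 ≤ A := integral_nonneg fun y => by positivity
  have hderiv_bound : ∀ z ∈ Set.Icc 0 h, |f' z - f' 0| ≤ √(h * A) := fun z hz =>
    Real.abs_le_sqrt ((sq_deriv_sub_deriv_zero_le hf'' hcont hInt hz.1).trans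
      (mul_le_mul_of_nonneg_right hz.2 hA))
  have hbound : ∀ y ∈ Set.Icc 0 h, |f y - y * f' 0| ≤ √(h * A) * y := fun y hy => by
    have hd : ∀ x ∈ Set.Icc 0 h, HasDerivWithinAt (fun y => f y - y * f' 0)
        (f' x - f' 0) (Set.Icc 0 h) x := fun x hx => by
      simpa using ((hf' x hx.1).mono Set.Icc_subset_Ici_self).fun_sub
        ((hasDerivWithinAt_id x _).mul_const (f' 0))
    have := norm_image_sub_le_of_norm_deriv_le_segment' hd
      (fun x hx => hderiv_bound x (Set.Ico_subset_Icc_self hx)) y hy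
    simpa [hf0] using this
  have hfi : IntervalIntegrable f volume 0 h :=
    ContinuousOn.intervalIntegrable_of_Icc hh.le fun x hx =>
      (hf' x hx.1).continuousWithinAt.mono Set.Icc_subset_Ici_self
  have hid : IntervalIntegrable (fun y : ℝ => y * f' 0) volume 0 h :=
    (by fun_prop : Continuous fun y : ℝ => y * f' 0).intervalIntegrable _ _
  have hint : |(∫ y in (0 : ℝ)..h, f y) - h ^ 2 / 2 * f' 0| ≤ √(h * A) * (h ^ 2 / 2) := by
    have h1 := intervalIntegral.norm_integral_le_of_norm_le (μ := volume)
      (f := fun y => f y - y * f' 0) (g := fun y => √(h * A) * y) hh.le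
      (ae_of_all _ fun y hy => hbound y (Set.Ioc_subset_Icc_self hy))
      ((by fun_prop : Continuous fun y : ℝ => √(h * A) * y).intervalIntegrable _ _)
    rw [intervalIntegral.integral_sub hfi hid, intervalIntegral.integral_const_mul,
      integral_id] at h1
    simpa using h1
  have heq : 2 / h ^ 2 * (∫ y in (0 : ℝ)..h, f y) - f' 0 =
      2 / h ^ 2 * ((∫ y in (0 : ℝ)..h, f y) - h ^ 2 / 2 * f' 0) := by
    field_simp
  rw [← Real.sq_sqrt (mul_nonneg hh.le hA), sq_le_sq, abs_of_nonneg (Real.sqrt_nonneg _), heq,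
    abs_mul, abs_of_nonneg (by positivity : 0 ≤ 2 / h ^ 2)]
  calc _ ≤ 2 / h ^ 2 * (√(h * A) * (h ^ 2 / 2)) := by gcongr
    _ = _ := by field_simp

end HalfLine

/-- The triangle inequality in the plane, in coordinates. -/
theorem sqrt_sq_add_sq_le_add (a₁ a₂ b₁ b₂ : ℝ) :
    √(a₁ ^ 2 + a₂ ^ 2) ≤ √((a₁ - b₁) ^ 2 + (a₂ - b₂) ^ 2) + √(b₁ ^ 2 + b₂ ^ 2) := by
  have h := norm_le_norm_sub_add (!₂[a₁, a₂] : EuclideanSpace ℝ (Fin 2)) !₂[b₁, b₂]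
  simpa [EuclideanSpace.norm_eq, Fin.sum_univ_two] using h

/-- Convergence rate of the volume-imbalance interface coefficient to the Stefan-type
coefficient: for `ϱ : ℝ² → ℝ` Lipschitz on bounded sets, `f₁, f₂` twice continuously
differentiable on `[0,∞)` with `f₁(0) = f₂(0) = 0` and
`N = (‖f₁‖²_{H²(ℝ₊)} + ‖f₂‖²_{H²(ℝ₊)})^{1/2} < ∞`, and `L` a Lipschitz constant of `ϱ` on
the closed Euclidean ball of radius `2N`, one has for all `n ≥ 1`
`|ϱ(2n²∫_0^{1/n} f₁, 2n²∫_0^{1/n} f₂) − ϱ(f₁'(0), f₂'(0))| ≤ n^{-1/2} L N`. -/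
theorem interface_coefficient_convergence_rate (ϱ : ℝ → ℝ → ℝ)
    (hϱ : ∀ ρ : ℝ, 0 < ρ → ∃ K : ℝ, 0 ≤ K ∧ ∀ a₁ a₂ b₁ b₂ : ℝ,
      Real.sqrt (a₁ ^ 2 + a₂ ^ 2) ≤ ρ → Real.sqrt (b₁ ^ 2 + b₂ ^ 2) ≤ ρ →
      |ϱ a₁ a₂ - ϱ b₁ b₂| ≤ K * Real.sqrt ((a₁ - b₁) ^ 2 + (a₂ - b₂) ^ 2))
    (f₁ f₁' f₁'' f₂ f₂' f₂'' : ℝ → ℝ)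
    (hf₁' : ∀ x ∈ Set.Ici (0 : ℝ), HasDerivWithinAt f₁ (f₁' x) (Set.Ici 0) x)
    (hf₁'' : ∀ x ∈ Set.Ici (0 : ℝ), HasDerivWithinAt f₁' (f₁'' x) (Set.Ici 0) x)
    (hcont₁ : ContinuousOn f₁'' (Set.Ici (0 : ℝ)))
    (hf₂' : ∀ x ∈ Set.Ici (0 : ℝ), HasDerivWithinAt f₂ (f₂' x) (Set.Ici 0) x)
    (hf₂'' : ∀ x ∈ Set.Ici (0 : ℝ), HasDerivWithinAt f₂' (f₂'' x) (Set.Ici 0) x)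
    (hcont₂ : ContinuousOn f₂'' (Set.Ici (0 : ℝ)))
    (hf₁0 : f₁ 0 = 0) (hf₂0 : f₂ 0 = 0)
    (hInt₁ : IntegrableOn (fun y => f₁ y ^ 2 + f₁' y ^ 2 + f₁'' y ^ 2) (Set.Ioi (0 : ℝ)))
    (hInt₂ : IntegrableOn (fun y => f₂ y ^ 2 + f₂' y ^ 2 + f₂'' y ^ 2) (Set.Ioi (0 : ℝ)))
    (N L : ℝ)
    (hN : N = Real.sqrt ((∫ y in Set.Ioi (0 : ℝ), (f₁ y ^ 2 + f₁' y ^ 2 + f₁'' y ^ 2)) +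
      (∫ y in Set.Ioi (0 : ℝ), (f₂ y ^ 2 + f₂' y ^ 2 + f₂'' y ^ 2))))
    (hL0 : 0 ≤ L)
    (hL : ∀ a₁ a₂ b₁ b₂ : ℝ,
      Real.sqrt (a₁ ^ 2 + a₂ ^ 2) ≤ 2 * N → Real.sqrt (b₁ ^ 2 + b₂ ^ 2) ≤ 2 * N →
      |ϱ a₁ a₂ - ϱ b₁ b₂| ≤ L * Real.sqrt ((a₁ - b₁) ^ 2 + (a₂ - b₂) ^ 2)) :
    ∀ n : ℕ, 1 ≤ n →
      |ϱ (2 * (n : ℝ) ^ 2 * ∫ y in (0 : ℝ)..(1 / (n : ℝ)), f₁ y)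
          (2 * (n : ℝ) ^ 2 * ∫ y in (0 : ℝ)..(1 / (n : ℝ)), f₂ y) -
        ϱ (f₁' 0) (f₂' 0)| ≤ L * N / Real.sqrt (n : ℝ) := by
  intro n hn
  have hn1 : (1 : ℝ) ≤ n := by exact_mod_cast hn
  have hn0 : (0 : ℝ) < n := by linarith
  have e₁ := sq_average_sub_deriv_zero_le hf₁' hf₁'' hcont₁ hf₁0 hInt₁ (one_div_pos.2 hn0)
  have e₂ := sq_average_sub_deriv_zero_le hf₂' hf₂'' hcont₂ hf₂0 hInt₂ (one_div_pos.2 hn0)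
  have t₁ := sq_deriv_zero_le_integral hf₁'' hcont₁ hInt₁
  have t₂ := sq_deriv_zero_le_integral hf₂'' hcont₂ hInt₂
  have hscale : 2 / (1 / (n : ℝ)) ^ 2 = 2 * (n : ℝ) ^ 2 := by field_simp
  rw [hscale] at e₁ e₂
  have hN0 : 0 ≤ N := hN ▸ Real.sqrt_nonneg _
  have hb : √(f₁' 0 ^ 2 + f₂' 0 ^ 2) ≤ N := by
    rw [hN]
    exact Real.sqrt_le_sqrt (add_le_add t₁ t₂)
  have hdiff : √((2 * (n : ℝ) ^ 2 * (∫ y in (0 : ℝ)..(1 / (n : ℝ)), f₁ y) - f₁' 0) ^ 2 +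
      (2 * (n : ℝ) ^ 2 * (∫ y in (0 : ℝ)..(1 / (n : ℝ)), f₂ y) - f₂' 0) ^ 2) ≤ N / √(n : ℝ) := by
    rw [hN, ← Real.sqrt_div' _ hn0.le]
    refine Real.sqrt_le_sqrt ((add_le_add e₁ e₂).trans_eq ?_)
    ring
  have hNn : N / √(n : ℝ) ≤ N := div_le_self hN0 (Real.one_le_sqrt.2 hn1)
  refine (hL _ _ _ _ ((sqrt_sq_add_sq_le_add _ _ (f₁' 0) (f₂' 0)).trans ?_)
    (by linarith)).trans ?_
  · linarith
  · rw [mul_div_assoc]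
    exact mul_le_mul_of_nonneg_left hdiff hL0
end

section
/- Let ϱ : ℝ² → ℝ be Lipschitz on bounded sets and let r ∈ (0,∞). Let f₁, f₂, g₁, g₂ : ℝ → ℝ be twice continuously differentiable on [0,∞) with f₁(0) = f₂(0) = g₁(0) = g₂(0) = 0, (‖f₁‖²_{H²(ℝ₊)} + ‖f₂‖²_{H²(ℝ₊)})^{1/2} ≤ r and (‖g₁‖²_{H²(ℝ₊)} + ‖g₂‖²_{H²(ℝ₊)})^{1/2} ≤ r, and let L be a Lipschitz constant of ϱ on the closed Euclidean ball in ℝ² of radius 2r. Then for every n ∈ ℕ, n ≥ 1, |ϱ(2n²·∫_0^{1/n} f₁(y) dy, 2n²·∫_0^{1/n} f₂(y) dy) − ϱ(2n²·∫_0^{1/n} g₁(y) dy, 2n²·∫_0^{1/n} g₂(y) dy)| ≤ 2 · L · (‖f₁−g₁‖²_{H²(ℝ₊)} + ‖f₂−g₂‖²_{H²(ℝ₊)})^{1/2}; in particular the approximate interface functionals are Lipschitz on bounded sets with a Lipschitz constant independent of n. -/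
open MeasureTheory

/-- The one-dimensional Sobolev bound `|h' x|² ≤ ‖h‖²_{H²(ℝ₊)}`. -/
theorem deriv_sq_le_integral {h h' h'' : ℝ → ℝ}
    (hd' : ∀ x ∈ Set.Ici (0 : ℝ), HasDerivWithinAt h' (h'' x) (Set.Ici 0) x)
    (hcont : ContinuousOn h'' (Set.Ici (0 : ℝ)))
    (hInt : IntegrableOn (fun y => h y ^ 2 + h' y ^ 2 + h'' y ^ 2) (Set.Ioi (0 : ℝ)))
    {x : ℝ} (hx : 0 ≤ x) :
    h' x ^ 2 ≤ ∫ y in Set.Ioi (0 : ℝ), (h y ^ 2 + h' y ^ 2 + h'' y ^ 2) := by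
  set N := ∫ y in Set.Ioi (0 : ℝ), (h y ^ 2 + h' y ^ 2 + h'' y ^ 2) with hN
  by_contra! hlt
  have hc' : ContinuousOn h' (Set.Ici (0 : ℝ)) := fun y hy => (hd' y hy).continuousWithinAt
  have lower : ∀ T, x < T → h' x ^ 2 - N ≤ h' T ^ 2 := by
    intro T hT
    have hsub : Set.Icc x T ⊆ Set.Ici 0 := fun y hy => hx.trans hy.1
    have hcd : ContinuousOn (fun y => 2 * h' y * h'' y) (Set.Icc x T) :=
      ((continuousOn_const.mul hc').mul hcont).mono hsub
    have hii : IntervalIntegrable (fun y => 2 * h' y * h'' y) volume x T :=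
      hcd.intervalIntegrable_of_Icc hT.le
    have ftc : ∫ y in x..T, 2 * h' y * h'' y = h' T ^ 2 - h' x ^ 2 := by
      refine intervalIntegral.integral_eq_sub_of_hasDerivAt_of_le (f := fun y => h' y ^ 2) hT.le
        ((hc'.pow 2).mono hsub) (fun y hy => ?_) hii
      have hy0 : 0 < y := hx.trans_lt hy.1
      simpa using ((hd' y hy0.le).hasDerivAt (Ici_mem_nhds hy0)).fun_pow 2
    have hlow : -N ≤ ∫ y in x..T, 2 * h' y * h'' y := by
      have hsub' : Set.Ioc x T ⊆ Set.Ioi 0 := fun y hy => hx.trans_lt hy.1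
      calc -N ≤ -∫ y in Set.Ioc x T, (h y ^ 2 + h' y ^ 2 + h'' y ^ 2) :=
            neg_le_neg (setIntegral_mono_set hInt
              (Filter.Eventually.of_forall fun y => by positivity) hsub'.eventuallyLE)
        _ = ∫ y in Set.Ioc x T, -(h y ^ 2 + h' y ^ 2 + h'' y ^ 2) := (integral_neg _).symm
        _ ≤ ∫ y in Set.Ioc x T, 2 * h' y * h'' y :=
            integral_mono (hInt.mono_set hsub').neg hii.1
              fun y => by
                dsimp only
                nlinarith [sq_nonneg (h' y + h'' y), sq_nonneg (h y)]
        _ = ∫ y in x..T, 2 * h' y * h'' y := (intervalIntegral.integral_of_le hT.le).symm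
    linarith
  have hconst : IntegrableOn (fun _ : ℝ => h' x ^ 2 - N) (Set.Ioi x) := by
    refine Integrable.mono' (hInt.mono_set (Set.Ioi_subset_Ioi hx)) aestronglyMeasurable_const ?_
    refine (ae_restrict_iff' measurableSet_Ioi).2 (Filter.Eventually.of_forall fun T hT => ?_)
    rw [Real.norm_of_nonneg (sub_pos.2 hlt).le]
    nlinarith [lower T hT, sq_nonneg (h T), sq_nonneg (h'' T)]
  rw [integrableOn_const_iff] at hconst
  rcases hconst with h0 | h0
  · exact (sub_pos.2 hlt).ne' (enorm_eq_zero.1 h0)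
  · simp at h0

theorem scaled_integral_sq_le_integral {h h' h'' : ℝ → ℝ}
    (hd : ∀ x ∈ Set.Ici (0 : ℝ), HasDerivWithinAt h (h' x) (Set.Ici 0) x)
    (hd' : ∀ x ∈ Set.Ici (0 : ℝ), HasDerivWithinAt h' (h'' x) (Set.Ici 0) x)
    (hcont : ContinuousOn h'' (Set.Ici (0 : ℝ))) (h0 : h 0 = 0)
    (hInt : IntegrableOn (fun y => h y ^ 2 + h' y ^ 2 + h'' y ^ 2) (Set.Ioi (0 : ℝ)))
    {n : ℕ} (hn : 1 ≤ n) :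
    (2 * (n : ℝ) ^ 2 * ∫ y in (0 : ℝ)..(1 / (n : ℝ)), h y) ^ 2 ≤
      ∫ y in Set.Ioi (0 : ℝ), (h y ^ 2 + h' y ^ 2 + h'' y ^ 2) := by
  set N := ∫ y in Set.Ioi (0 : ℝ), (h y ^ 2 + h' y ^ 2 + h'' y ^ 2) with hN
  have hN0 : 0 ≤ N := integral_nonneg fun y => by positivity
  have hn0 : (0 : ℝ) < n := by exact_mod_cast hn
  have hbound : ∀ y, 0 ≤ y → ‖h y‖ ≤ Real.sqrt N * y := by
    intro y hy
    have := (convex_Ici (0 : ℝ)).norm_image_sub_le_of_norm_hasDerivWithin_le hd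
      (fun x hx => Real.abs_le_sqrt (deriv_sq_le_integral hd' hcont hInt hx))
      (Set.mem_Ici.2 le_rfl) (Set.mem_Ici.2 hy)
    simpa [h0, abs_of_nonneg hy] using this
  have hint : ‖∫ y in (0 : ℝ)..(1 / (n : ℝ)), h y‖ ≤
      ∫ y in (0 : ℝ)..(1 / (n : ℝ)), Real.sqrt N * y :=
    intervalIntegral.norm_integral_le_of_norm_le (by positivity)
      (Filter.Eventually.of_forall fun y hy => hbound y hy.1.le)
      (Continuous.intervalIntegrable (by fun_prop) _ _)
  rw [intervalIntegral.integral_const_mul, integral_id, Real.norm_eq_abs] at hint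
  refine (sq_le_sq₀ (abs_nonneg _) (Real.sqrt_nonneg N)).2 ?_ |>.trans_eq (Real.sq_sqrt hN0) |>
    (sq_abs _).symm.le.trans
  rw [abs_mul, abs_of_pos (by positivity : (0 : ℝ) < 2 * (n : ℝ) ^ 2)]
  calc _ ≤ 2 * (n : ℝ) ^ 2 * (Real.sqrt N * (((1 / (n : ℝ)) ^ 2 - 0 ^ 2) / 2)) := by gcongr
    _ = Real.sqrt N := by field_simp; ring

theorem integrableOn_sq_sub {f f' f'' g g' g'' : ℝ → ℝ}
    (hf : ContinuousOn f (Set.Ici 0)) (hf' : ContinuousOn f' (Set.Ici 0))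
    (hf'' : ContinuousOn f'' (Set.Ici 0))
    (hg : ContinuousOn g (Set.Ici 0)) (hg' : ContinuousOn g' (Set.Ici 0))
    (hg'' : ContinuousOn g'' (Set.Ici 0))
    (hfI : IntegrableOn (fun y => f y ^ 2 + f' y ^ 2 + f'' y ^ 2) (Set.Ioi (0 : ℝ)))
    (hgI : IntegrableOn (fun y => g y ^ 2 + g' y ^ 2 + g'' y ^ 2) (Set.Ioi (0 : ℝ))) :
    IntegrableOn (fun y => (f y - g y) ^ 2 + (f' y - g' y) ^ 2 + (f'' y - g'' y) ^ 2)
      (Set.Ioi (0 : ℝ)) := by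
  refine Integrable.mono' ((hfI.add hgI).const_mul 2) ?_ (Filter.Eventually.of_forall fun y => ?_)
  · exact (((((hf.sub hg).pow 2).add ((hf'.sub hg').pow 2)).add ((hf''.sub hg'').pow 2)).mono
      Set.Ioi_subset_Ici_self).aestronglyMeasurable measurableSet_Ioi
  · rw [Real.norm_of_nonneg (by positivity)]
    simp only [Pi.add_apply]
    nlinarith [sq_nonneg (f y + g y), sq_nonneg (f' y + g' y), sq_nonneg (f'' y + g'' y)]

theorem scaled_integral_sub_sq_le_integral {f f' f'' g g' g'' : ℝ → ℝ}
    (hf : ∀ x ∈ Set.Ici (0 : ℝ), HasDerivWithinAt f (f' x) (Set.Ici 0) x)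
    (hf' : ∀ x ∈ Set.Ici (0 : ℝ), HasDerivWithinAt f' (f'' x) (Set.Ici 0) x)
    (hf'' : ContinuousOn f'' (Set.Ici (0 : ℝ)))
    (hg : ∀ x ∈ Set.Ici (0 : ℝ), HasDerivWithinAt g (g' x) (Set.Ici 0) x)
    (hg' : ∀ x ∈ Set.Ici (0 : ℝ), HasDerivWithinAt g' (g'' x) (Set.Ici 0) x)
    (hg'' : ContinuousOn g'' (Set.Ici (0 : ℝ))) (hf0 : f 0 = 0) (hg0 : g 0 = 0)
    (hfI : IntegrableOn (fun y => f y ^ 2 + f' y ^ 2 + f'' y ^ 2) (Set.Ioi (0 : ℝ)))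
    (hgI : IntegrableOn (fun y => g y ^ 2 + g' y ^ 2 + g'' y ^ 2) (Set.Ioi (0 : ℝ)))
    {n : ℕ} (hn : 1 ≤ n) :
    (2 * (n : ℝ) ^ 2 * (∫ y in (0 : ℝ)..(1 / (n : ℝ)), f y) -
      2 * (n : ℝ) ^ 2 * ∫ y in (0 : ℝ)..(1 / (n : ℝ)), g y) ^ 2 ≤
      ∫ y in Set.Ioi (0 : ℝ),
        ((f y - g y) ^ 2 + (f' y - g' y) ^ 2 + (f'' y - g'' y) ^ 2) := by
  have cont : ∀ {u u' : ℝ → ℝ}, (∀ x ∈ Set.Ici (0 : ℝ), HasDerivWithinAt u (u' x) (Set.Ici 0) x) →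
      ContinuousOn u (Set.Ici (0 : ℝ)) := fun hu x hx => (hu x hx).continuousWithinAt
  have hii : ∀ {u : ℝ → ℝ}, ContinuousOn u (Set.Ici (0 : ℝ)) →
      IntervalIntegrable u volume 0 (1 / (n : ℝ)) := fun hu =>
    (hu.mono fun _ hy => hy.1).intervalIntegrable_of_Icc (by positivity)
  rw [← mul_sub, ← intervalIntegral.integral_sub (hii (cont hf)) (hii (cont hg))]
  exact scaled_integral_sq_le_integral (fun x hx => (hf x hx).sub (hg x hx))
    (fun x hx => (hf' x hx).sub (hg' x hx)) (hf''.sub hg'') (by simp [hf0, hg0])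
    (integrableOn_sq_sub (cont hf) (cont hf') hf'' (cont hg) (cont hg') hg'' hfI hgI) hn

/-- Uniform-in-`n` Lipschitz estimate for the approximate volume-imbalance interface
functionals: for `ϱ : ℝ² → ℝ` Lipschitz on bounded sets with Lipschitz constant `L` on
the closed Euclidean ball of radius `2r`, and `f₁, f₂, g₁, g₂` twice continuously
differentiable on `[0,∞)`, vanishing at `0`, with `H²(ℝ₊)`-direct-sum norms bounded
by `r`, one has for all `n ≥ 1`
`|ϱ(2n²∫_0^{1/n} f₁, 2n²∫_0^{1/n} f₂) − ϱ(2n²∫_0^{1/n} g₁, 2n²∫_0^{1/n} g₂)|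
  ≤ 2L (‖f₁−g₁‖²_{H²(ℝ₊)} + ‖f₂−g₂‖²_{H²(ℝ₊)})^{1/2}`. -/
theorem interface_functionals_uniformly_lipschitz (ϱ : ℝ → ℝ → ℝ) (r : ℝ) (hr : 0 < r)
    (hϱ : ∀ ρ : ℝ, 0 < ρ → ∃ K : ℝ, 0 ≤ K ∧ ∀ a₁ a₂ b₁ b₂ : ℝ,
      Real.sqrt (a₁ ^ 2 + a₂ ^ 2) ≤ ρ → Real.sqrt (b₁ ^ 2 + b₂ ^ 2) ≤ ρ →
      |ϱ a₁ a₂ - ϱ b₁ b₂| ≤ K * Real.sqrt ((a₁ - b₁) ^ 2 + (a₂ - b₂) ^ 2))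
    (f₁ f₁' f₁'' f₂ f₂' f₂'' g₁ g₁' g₁'' g₂ g₂' g₂'' : ℝ → ℝ)
    (hf₁' : ∀ x ∈ Set.Ici (0 : ℝ), HasDerivWithinAt f₁ (f₁' x) (Set.Ici 0) x)
    (hf₁'' : ∀ x ∈ Set.Ici (0 : ℝ), HasDerivWithinAt f₁' (f₁'' x) (Set.Ici 0) x)
    (hcontf₁ : ContinuousOn f₁'' (Set.Ici (0 : ℝ)))
    (hf₂' : ∀ x ∈ Set.Ici (0 : ℝ), HasDerivWithinAt f₂ (f₂' x) (Set.Ici 0) x)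
    (hf₂'' : ∀ x ∈ Set.Ici (0 : ℝ), HasDerivWithinAt f₂' (f₂'' x) (Set.Ici 0) x)
    (hcontf₂ : ContinuousOn f₂'' (Set.Ici (0 : ℝ)))
    (hg₁' : ∀ x ∈ Set.Ici (0 : ℝ), HasDerivWithinAt g₁ (g₁' x) (Set.Ici 0) x)
    (hg₁'' : ∀ x ∈ Set.Ici (0 : ℝ), HasDerivWithinAt g₁' (g₁'' x) (Set.Ici 0) x)
    (hcontg₁ : ContinuousOn g₁'' (Set.Ici (0 : ℝ)))
    (hg₂' : ∀ x ∈ Set.Ici (0 : ℝ), HasDerivWithinAt g₂ (g₂' x) (Set.Ici 0) x)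
    (hg₂'' : ∀ x ∈ Set.Ici (0 : ℝ), HasDerivWithinAt g₂' (g₂'' x) (Set.Ici 0) x)
    (hcontg₂ : ContinuousOn g₂'' (Set.Ici (0 : ℝ)))
    (hf₁0 : f₁ 0 = 0) (hf₂0 : f₂ 0 = 0) (hg₁0 : g₁ 0 = 0) (hg₂0 : g₂ 0 = 0)
    (hIntf₁ : IntegrableOn (fun y => f₁ y ^ 2 + f₁' y ^ 2 + f₁'' y ^ 2) (Set.Ioi (0 : ℝ)))
    (hIntf₂ : IntegrableOn (fun y => f₂ y ^ 2 + f₂' y ^ 2 + f₂'' y ^ 2) (Set.Ioi (0 : ℝ)))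
    (hIntg₁ : IntegrableOn (fun y => g₁ y ^ 2 + g₁' y ^ 2 + g₁'' y ^ 2) (Set.Ioi (0 : ℝ)))
    (hIntg₂ : IntegrableOn (fun y => g₂ y ^ 2 + g₂' y ^ 2 + g₂'' y ^ 2) (Set.Ioi (0 : ℝ)))
    (hNf : Real.sqrt ((∫ y in Set.Ioi (0 : ℝ), (f₁ y ^ 2 + f₁' y ^ 2 + f₁'' y ^ 2)) +
      (∫ y in Set.Ioi (0 : ℝ), (f₂ y ^ 2 + f₂' y ^ 2 + f₂'' y ^ 2))) ≤ r)
    (hNg : Real.sqrt ((∫ y in Set.Ioi (0 : ℝ), (g₁ y ^ 2 + g₁' y ^ 2 + g₁'' y ^ 2)) +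
      (∫ y in Set.Ioi (0 : ℝ), (g₂ y ^ 2 + g₂' y ^ 2 + g₂'' y ^ 2))) ≤ r)
    (L : ℝ) (hL0 : 0 ≤ L)
    (hL : ∀ a₁ a₂ b₁ b₂ : ℝ,
      Real.sqrt (a₁ ^ 2 + a₂ ^ 2) ≤ 2 * r → Real.sqrt (b₁ ^ 2 + b₂ ^ 2) ≤ 2 * r →
      |ϱ a₁ a₂ - ϱ b₁ b₂| ≤ L * Real.sqrt ((a₁ - b₁) ^ 2 + (a₂ - b₂) ^ 2)) :
    ∀ n : ℕ, 1 ≤ n →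
      |ϱ (2 * (n : ℝ) ^ 2 * ∫ y in (0 : ℝ)..(1 / (n : ℝ)), f₁ y)
          (2 * (n : ℝ) ^ 2 * ∫ y in (0 : ℝ)..(1 / (n : ℝ)), f₂ y) -
        ϱ (2 * (n : ℝ) ^ 2 * ∫ y in (0 : ℝ)..(1 / (n : ℝ)), g₁ y)
          (2 * (n : ℝ) ^ 2 * ∫ y in (0 : ℝ)..(1 / (n : ℝ)), g₂ y)| ≤
      2 * L * Real.sqrt
        ((∫ y in Set.Ioi (0 : ℝ),
            ((f₁ y - g₁ y) ^ 2 + (f₁' y - g₁' y) ^ 2 + (f₁'' y - g₁'' y) ^ 2)) +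
          (∫ y in Set.Ioi (0 : ℝ),
            ((f₂ y - g₂ y) ^ 2 + (f₂' y - g₂' y) ^ 2 + (f₂'' y - g₂'' y) ^ 2))) := by
  intro n hn
  have hf := add_le_add (scaled_integral_sq_le_integral hf₁' hf₁'' hcontf₁ hf₁0 hIntf₁ hn)
    (scaled_integral_sq_le_integral hf₂' hf₂'' hcontf₂ hf₂0 hIntf₂ hn)
  have hg := add_le_add (scaled_integral_sq_le_integral hg₁' hg₁'' hcontg₁ hg₁0 hIntg₁ hn)
    (scaled_integral_sq_le_integral hg₂' hg₂'' hcontg₂ hg₂0 hIntg₂ hn)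
  have hd := add_le_add
    (scaled_integral_sub_sq_le_integral hf₁' hf₁'' hcontf₁ hg₁' hg₁'' hcontg₁ hf₁0 hg₁0
      hIntf₁ hIntg₁ hn)
    (scaled_integral_sub_sq_le_integral hf₂' hf₂'' hcontf₂ hg₂' hg₂'' hcontg₂ hf₂0 hg₂0
      hIntf₂ hIntg₂ hn)
  refine (hL _ _ _ _ ((Real.sqrt_le_sqrt hf).trans (by linarith))
    ((Real.sqrt_le_sqrt hg).trans (by linarith))).trans ?_
  refine (mul_le_mul_of_nonneg_left (Real.sqrt_le_sqrt hd) hL0).trans ?_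
  exact mul_le_mul_of_nonneg_right (by linarith) (Real.sqrt_nonneg _)
end
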